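/- Let L_k denote the poset of reversible gate classes over an alphabet of size k, ordered by inclusion. For every k ≥ 2 there is a poset embedding P : L_k → L_{k+1}, i.e. an injective order-preserving map of posets. Concretely, with A = {1,…,k} and A' = {1,…,k+1}, for a gate F over A let PF be the gate over A' that fixes any input containing the symbol k+1 and acts as F otherwise, and for a gate class S over A let PS = ⟨PF : F ∈ S⟩; then S ↦ PS is injective and order-preserving. -/

import Mathlib

/-- A reversible gate function of arity `n` over alphabet `A`: a bijection `A^n → A^n`. -/
abbrev GateFun (A : Type*) (n : ℕ) := (Fin n → A) ≃ (Fin n → A)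

/-- A reversible gate over alphabet `A`: an arity together with a bijection of that arity. -/
abbrev Gate (A : Type*) := Σ n : ℕ, GateFun A n

/-- The canonical identification `A^{n+m} ≃ A^n × A^m`. -/
def splitEquiv (A : Type*) (n m : ℕ) :
    (Fin (n + m) → A) ≃ ((Fin n → A) × (Fin m → A)) :=
  (Equiv.arrowCongr finSumFinEquiv.symm (Equiv.refl A)).trans
    (Equiv.sumArrowEquivProdArrow _ _ A)

/-- The permutation gate `P_σ`, mapping `(a_1,…,a_n)` to `(a_{σ(1)},…,a_{σ(n)})`. -/
def permGate (A : Type*) {n : ℕ} (σ : Equiv.Perm (Fin n)) : GateFun A n :=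
  Equiv.arrowCongr σ.symm (Equiv.refl A)

/-- Tensor product of gates. -/
def tensorGate {A : Type*} {n m : ℕ} (F : GateFun A n) (G : GateFun A m) :
    GateFun A (n + m) :=
  ((splitEquiv A n m).trans (F.prodCongr G)).trans (splitEquiv A n m).symm

/-- The generation relation: `Generates S g` means `g` can be generated from the set `S`
of reversible gates using the permutation, tensor product, composition and ancilla rules. -/
inductive Generates {A : Type*} (S : Set (Gate A)) : Gate A → Prop
  | mem {g : Gate A} : g ∈ S → Generates S g
  | perm (n : ℕ) (σ : Equiv.Perm (Fin n)) : Generates S ⟨n, permGate A σ⟩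
  | tensor {n m : ℕ} {F : GateFun A n} {G : GateFun A m} :
      Generates S ⟨n, F⟩ → Generates S ⟨m, G⟩ → Generates S ⟨n + m, tensorGate F G⟩
  | comp {n : ℕ} {F G : GateFun A n} :
      Generates S ⟨n, F⟩ → Generates S ⟨n, G⟩ → Generates S ⟨n, G.trans F⟩
  | ancilla {l m : ℕ} {F : GateFun A (l + m)} (a : Fin l → A) {F' : GateFun A m} :
      Generates S ⟨l + m, F⟩ →
      (∀ b : Fin m → A,
        F ((splitEquiv A l m).symm (a, b)) = (splitEquiv A l m).symm (a, F' b)) →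
      Generates S ⟨m, F'⟩

/-- The gate class `⟨S⟩` generated by a set `S` of reversible gates. -/
def genClosure {A : Type*} (S : Set (Gate A)) : Set (Gate A) := {g | Generates S g}

/-- A reversible gate class: a set of gates closed under the generation rules. -/
def IsGateClass {A : Type*} (S : Set (Gate A)) : Prop := ∀ g, Generates S g → g ∈ S

/-- The transposition gate `τ_{u,v}` exchanging the inputs `u` and `v`. -/
def tau {A : Type*} [DecidableEq A] {n : ℕ} (u v : Fin n → A) : GateFun A n :=
  Equiv.swap u v

/-- The controlled gate `w-F`, mapping `w u` to `w F(u)` and fixing all other inputs. -/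
def controlled {A : Type*} [DecidableEq A] {l n : ℕ} (w : Fin l → A) (F : GateFun A n) :
    GateFun A (l + n) :=
  ((splitEquiv A l n).trans
    (Equiv.prodCongrRight fun p => if p = w then F else Equiv.refl _)).trans
    (splitEquiv A l n).symm

/-- `SWAP_{a,b}` for single symbols `a`, `b`: exchanges `ab` and `ba`. -/
def swapGate {A : Type*} [DecidableEq A] (a b : A) : GateFun A 2 :=
  tau ![a, b] ![b, a]

/-- Number of occurrences of the symbol `a` in the string `x`. -/
def countOf {A : Type*} [DecidableEq A] {n : ℕ} (a : A) (x : Fin n → A) : ℕ :=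
  (Finset.univ.filter fun i => x i = a).card

/-- Strings over `Fin k` correspond to strings over `Fin (k+1)` avoiding the new
symbol `k+1` (the top element of `Fin (k+1)`). -/
def liftEquiv (k n : ℕ) : (Fin n → Fin k) ≃ {x : Fin n → Fin (k + 1) // ∀ i, (x i : ℕ) < k} where
  toFun u := ⟨fun i => (u i).castSucc, fun i => by simpa using (u i).isLt⟩
  invFun x := fun i => ⟨(x.1 i : ℕ), x.2 i⟩
  left_inv u := by funext i; apply Fin.ext; simp
  right_inv x := by
    apply Subtype.ext; funext i; apply Fin.ext; simp

/-- The gate `PF` over `{1,…,k+1}` induced by the gate `F` over `{1,…,k}`: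
it fixes any input containing the new symbol `k+1` and acts as `F` otherwise. -/
def pgate {k : ℕ} (g : Gate (Fin k)) : Gate (Fin (k + 1)) :=
  ⟨g.1, Equiv.Perm.extendDomain g.2 (liftEquiv k g.1)⟩

/-- A gate class is closed under composing two of its gates. -/
theorem IsGateClass.trans_mem {A : Type*} {S : Set (Gate A)} (hS : IsGateClass S) {n : ℕ}
    {F G : GateFun A n} (hF : ⟨n, F⟩ ∈ S) (hG : ⟨n, G⟩ ∈ S) : (⟨n, F.trans G⟩ : Gate A) ∈ S :=
  hS _ (.comp (.mem hG) (.mem hF))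

theorem IsGateClass.permGate_mem {A : Type*} {S : Set (Gate A)} (hS : IsGateClass S) {n : ℕ}
    (σ : Equiv.Perm (Fin n)) : (⟨n, permGate A σ⟩ : Gate A) ∈ S :=
  hS _ (.perm n σ)

theorem IsGateClass.refl_mem {A : Type*} {S : Set (Gate A)} (hS : IsGateClass S) (n : ℕ) :
    (⟨n, Equiv.refl _⟩ : Gate A) ∈ S :=
  hS.permGate_mem (Equiv.refl _)

theorem Generates.mono {A : Type*} {S T : Set (Gate A)} (h : S ⊆ T) {g : Gate A}
    (hg : Generates S g) : Generates T g := by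
  induction hg with
  | mem hg => exact .mem (h hg)
  | perm n σ => exact .perm n σ
  | tensor _ _ h₁ h₂ => exact .tensor h₁ h₂
  | comp _ _ h₁ h₂ => exact .comp h₁ h₂
  | ancilla a _ hF h₁ => exact .ancilla a h₁ hF

theorem permGate_apply {A : Type*} {n : ℕ} (σ : Equiv.Perm (Fin n)) (x : Fin n → A) :
    permGate A σ x = x ∘ σ := rfl

theorem splitEquiv_symm_apply {A : Type*} {n m : ℕ} (a : Fin n → A) (b : Fin m → A) :
    (splitEquiv A n m).symm (a, b) = Fin.append a b := by
  funext x
  refine Fin.addCases (fun y => ?_) (fun y => ?_) x <;> simp [splitEquiv, Equiv.arrowCongr]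

theorem append_inj {A : Type*} {n m : ℕ} {a a' : Fin n → A} {b b' : Fin m → A}
    (h : Fin.append a b = Fin.append a' b') : a = a' ∧ b = b' := by
  simpa only [← splitEquiv_symm_apply, EmbeddingLike.apply_eq_iff_eq, Prod.mk.injEq] using h

theorem exists_eq_append {A : Type*} {n m : ℕ} (x : Fin (n + m) → A) :
    ∃ a b, x = Fin.append a b :=
  ⟨_, _, (Fin.append_castAdd_natAdd (f := x)).symm⟩

theorem tensorGate_append {A : Type*} {n m : ℕ} (F : GateFun A n) (G : GateFun A m)
    (a : Fin n → A) (b : Fin m → A) :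
    tensorGate F G (Fin.append a b) = Fin.append (F a) (G b) := by
  simp [← splitEquiv_symm_apply, tensorGate]

/-- The string with the symbols of `u` at the positions given by `i`, and the new symbol
everywhere else. -/
noncomputable def padLast {k m n : ℕ} (i : Fin m ↪ Fin n) (u : Fin m → Fin k) :
    Fin n → Fin (k + 1) :=
  Function.extend i (Fin.castSucc ∘ u) fun _ => Fin.last k

theorem padLast_apply {k m n : ℕ} (i : Fin m ↪ Fin n) (u : Fin m → Fin k) (x : Fin m) :
    padLast i u (i x) = (u x).castSucc :=
  i.injective.extend_apply _ _ x

theorem padLast_of_notMem {k m n : ℕ} (i : Fin m ↪ Fin n) (u : Fin m → Fin k) {y : Fin n}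
    (hy : y ∉ Set.range i) : padLast i u y = Fin.last k :=
  Function.extend_apply' _ _ _ hy

theorem padLast_ne_last_iff {k m n : ℕ} (i : Fin m ↪ Fin n) (u : Fin m → Fin k) (y : Fin n) :
    padLast i u y ≠ Fin.last k ↔ y ∈ Set.range i := by
  refine ⟨fun h => by_contra fun hy => h (padLast_of_notMem i u hy), ?_⟩
  rintro ⟨x, rfl⟩
  rw [padLast_apply]
  exact Fin.castSucc_ne_last _

theorem padLast_injective {k m n : ℕ} (i : Fin m ↪ Fin n) :
    Function.Injective (padLast (k := k) i) := by
  intro u v h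
  funext x
  simpa [padLast_apply] using congrFun h (i x)

theorem padLast_refl {k n : ℕ} (u : Fin n → Fin k) :
    padLast (Function.Embedding.refl _) u = Fin.castSucc ∘ u := by
  funext x
  exact padLast_apply (Function.Embedding.refl _) u x

theorem padLast_trans {k m m' n : ℕ} (π : Fin m' ≃ Fin m) (i : Fin m ↪ Fin n)
    (u : Fin m' → Fin k) :
    padLast (π.toEmbedding.trans i) u = padLast i (u ∘ π.symm) := by
  funext y
  by_cases hy : y ∈ Set.range i
  · obtain ⟨x, rfl⟩ := hy
    rw [padLast_apply]
    simpa using padLast_apply (π.toEmbedding.trans i) u (π.symm x)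
  · rw [padLast_of_notMem _ _ hy, padLast_of_notMem]
    rintro ⟨x, rfl⟩
    exact hy ⟨π x, rfl⟩

theorem padLast_comp_perm {k m n : ℕ} (σ : Equiv.Perm (Fin n)) (i : Fin m ↪ Fin n)
    (u : Fin m → Fin k) :
    padLast i u ∘ σ = padLast (i.trans σ.symm.toEmbedding) u := by
  funext y
  by_cases hy : σ y ∈ Set.range i
  · obtain ⟨x, hx⟩ := hy
    obtain rfl : y = (i.trans σ.symm.toEmbedding) x := by simp [hx]
    rw [padLast_apply, Function.comp_apply, ← hx, padLast_apply]
  · rw [Function.comp_apply, padLast_of_notMem _ _ hy, padLast_of_notMem]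
    rintro ⟨x, rfl⟩
    exact hy ⟨x, by simp⟩

/-- Placing two embeddings of index sets side by side. -/
def finSumEmb {l₀ n₀ l n : ℕ} (i : Fin l₀ ↪ Fin l) (j : Fin n₀ ↪ Fin n) :
    Fin (l₀ + n₀) ↪ Fin (l + n) :=
  (finSumFinEquiv.symm.toEmbedding.trans (i.sumMap j)).trans finSumFinEquiv.toEmbedding

theorem finSumEmb_castAdd {l₀ n₀ l n : ℕ} (i : Fin l₀ ↪ Fin l) (j : Fin n₀ ↪ Fin n)
    (x : Fin l₀) : finSumEmb i j (Fin.castAdd n₀ x) = Fin.castAdd n (i x) := by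
  simp [finSumEmb]

theorem finSumEmb_natAdd {l₀ n₀ l n : ℕ} (i : Fin l₀ ↪ Fin l) (j : Fin n₀ ↪ Fin n)
    (x : Fin n₀) : finSumEmb i j (Fin.natAdd l₀ x) = Fin.natAdd l (j x) := by
  simp [finSumEmb]

theorem castAdd_mem_range_finSumEmb {l₀ n₀ l n : ℕ} (i : Fin l₀ ↪ Fin l) (j : Fin n₀ ↪ Fin n)
    (y : Fin l) : Fin.castAdd n y ∈ Set.range (finSumEmb i j) ↔ y ∈ Set.range i := by
  constructor
  · rintro ⟨x, hx⟩
    induction x using Fin.addCases with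
    | left x =>
      rw [finSumEmb_castAdd] at hx
      exact ⟨x, Fin.castAdd_injective _ _ hx⟩
    | right x =>
      rw [finSumEmb_natAdd] at hx
      have := congrArg Fin.val hx
      simp at this
      omega
  · rintro ⟨x, rfl⟩
    exact ⟨_, finSumEmb_castAdd i j x⟩

theorem natAdd_mem_range_finSumEmb {l₀ n₀ l n : ℕ} (i : Fin l₀ ↪ Fin l) (j : Fin n₀ ↪ Fin n)
    (y : Fin n) : Fin.natAdd l y ∈ Set.range (finSumEmb i j) ↔ y ∈ Set.range j := by
  constructor
  · rintro ⟨x, hx⟩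
    induction x using Fin.addCases with
    | left x =>
      rw [finSumEmb_castAdd] at hx
      have := congrArg Fin.val hx
      simp at this
      omega
    | right x =>
      rw [finSumEmb_natAdd] at hx
      exact ⟨x, Fin.natAdd_injective _ _ hx⟩
  · rintro ⟨x, rfl⟩
    exact ⟨_, finSumEmb_natAdd i j x⟩

theorem padLast_finSumEmb {k l₀ n₀ l n : ℕ} (i : Fin l₀ ↪ Fin l) (j : Fin n₀ ↪ Fin n)
    (u : Fin l₀ → Fin k) (v : Fin n₀ → Fin k) :
    padLast (finSumEmb i j) (Fin.append u v) = Fin.append (padLast i u) (padLast j v) := by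
  funext y
  induction y using Fin.addCases with
  | left y =>
    rw [Fin.append_left]
    by_cases hy : y ∈ Set.range i
    · obtain ⟨x, rfl⟩ := hy
      rw [← finSumEmb_castAdd i j, padLast_apply, padLast_apply, Fin.append_left]
    · rw [padLast_of_notMem _ _ hy, padLast_of_notMem]
      rwa [castAdd_mem_range_finSumEmb]
  | right y =>
    rw [Fin.append_right]
    by_cases hy : y ∈ Set.range j
    · obtain ⟨x, rfl⟩ := hy
      rw [← finSumEmb_natAdd i j, padLast_apply, padLast_apply, Fin.append_right]
    · rw [padLast_of_notMem _ _ hy, padLast_of_notMem]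
      rwa [natAdd_mem_range_finSumEmb]

theorem exists_embedding_range_eq {n : ℕ} (s : Set (Fin n)) :
    ∃ (m : ℕ) (i : Fin m ↪ Fin n), Set.range i = s := by
  classical
  refine ⟨_, (Fintype.equivFin s).symm.toEmbedding.trans (Function.Embedding.subtype _), ?_⟩
  ext x
  constructor
  · rintro ⟨y, rfl⟩
    exact Subtype.prop _
  · exact fun hx => ⟨Fintype.equivFin s ⟨x, hx⟩, by simp⟩

theorem exists_equiv_trans_eq {α β γ : Type*} (i : α ↪ γ) (j : β ↪ γ)
    (h : Set.range i = Set.range j) : ∃ π : α ≃ β, π.toEmbedding.trans j = i := by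
  refine ⟨(Equiv.ofInjective i i.injective).trans
    ((Equiv.setCongr h).trans (Equiv.ofInjective j j.injective).symm), ?_⟩
  ext x
  simp [Equiv.apply_ofInjective_symm j.injective]

theorem exists_equiv_trans_refl_eq {α β : Type*} {i : α ↪ β} (h : Function.Surjective i) :
    ∃ π : α ≃ β, π.toEmbedding.trans (.refl β) = i :=
  ⟨Equiv.ofBijective i ⟨i.injective, h⟩, rfl⟩

/-- An embedding into `Fin (l + n)` splits, up to reindexing its domain, into its two parts, the
left one being parametrized by any given embedding with the right range. -/
theorem exists_equiv_trans_finSumEmb_eq {l₀ p l n : ℕ} (i : Fin l₀ ↪ Fin l)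
    (j : Fin p ↪ Fin (l + n)) (h : ∀ y, Fin.castAdd n y ∈ Set.range j ↔ y ∈ Set.range i) :
    ∃ (q : ℕ) (j' : Fin q ↪ Fin n) (π : Fin p ≃ Fin (l₀ + q)),
      π.toEmbedding.trans (finSumEmb i j') = j := by
  obtain ⟨q, j', hj'⟩ := exists_embedding_range_eq {y | Fin.natAdd l y ∈ Set.range j}
  refine ⟨q, j', exists_equiv_trans_eq _ _ ?_⟩
  ext y
  induction y using Fin.addCases with
  | left y => rw [h, castAdd_mem_range_finSumEmb]
  | right y => rw [natAdd_mem_range_finSumEmb, hj', Set.mem_ofPred_eq]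

/-- On the strings whose old symbols are at the positions given by `i`, the gate `G` moves the
pattern of new symbols uniformly and acts on the old symbols as a gate of `S`. -/
def RestrictsTo {k m n : ℕ} (S : Set (Gate (Fin k))) (G : GateFun (Fin (k + 1)) n)
    (i : Fin m ↪ Fin n) : Prop :=
  ∃ (j : Fin m ↪ Fin n) (H : GateFun (Fin k) m), ⟨m, H⟩ ∈ S ∧
    ∀ u, G (padLast i u) = padLast j (H u)

theorem RestrictsTo.trans_equiv {k m m' n : ℕ} {S : Set (Gate (Fin k))} (hS : IsGateClass S)
    {G : GateFun (Fin (k + 1)) n} {i : Fin m ↪ Fin n} (h : RestrictsTo S G i)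
    (π : Fin m' ≃ Fin m) : RestrictsTo S G (π.toEmbedding.trans i) := by
  obtain rfl : m' = m := Fin.equiv_iff_eq.1 ⟨π⟩
  obtain ⟨j, H, hH, hj⟩ := h
  refine ⟨j, (permGate _ π.symm).trans H, hS.trans_mem (hS.permGate_mem _) hH, fun u => ?_⟩
  rw [padLast_trans, hj]
  rfl

theorem extendDomain_castSucc {k n : ℕ} (F : GateFun (Fin k) n) (u : Fin n → Fin k) :
    Equiv.Perm.extendDomain F (liftEquiv k n) (Fin.castSucc ∘ u) = Fin.castSucc ∘ F u :=
  Equiv.Perm.extendDomain_apply_image F (liftEquiv k n) u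

theorem extendDomain_of_eq_last {k n : ℕ} (F : GateFun (Fin k) n) {x : Fin n → Fin (k + 1)}
    {y : Fin n} (hy : x y = Fin.last k) : Equiv.Perm.extendDomain F (liftEquiv k n) x = x :=
  Equiv.Perm.extendDomain_apply_not_subtype F (liftEquiv k n)
    fun h => by simpa [hy] using h y

theorem restrictsTo_extendDomain {k m n : ℕ} {S : Set (Gate (Fin k))} (hS : IsGateClass S)
    {F : GateFun (Fin k) n} (hF : ⟨n, F⟩ ∈ S) (i : Fin m ↪ Fin n) :
    RestrictsTo S (Equiv.Perm.extendDomain F (liftEquiv k n)) i := by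
  by_cases hi : Function.Surjective i
  · obtain ⟨π, rfl⟩ := exists_equiv_trans_refl_eq hi
    refine RestrictsTo.trans_equiv hS ⟨Function.Embedding.refl _, F, hF, fun u => ?_⟩ π
    rw [padLast_refl, padLast_refl, extendDomain_castSucc]
  · obtain ⟨y, hy⟩ := not_forall.1 hi
    exact ⟨i, Equiv.refl _, hS.refl_mem m,
      fun u => extendDomain_of_eq_last F (padLast_of_notMem i u hy)⟩

theorem RestrictsTo.tensor {k n n' m m' : ℕ} {S : Set (Gate (Fin k))} (hS : IsGateClass S)
    {F : GateFun (Fin (k + 1)) n} {G : GateFun (Fin (k + 1)) n'} {i : Fin m ↪ Fin n}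
    {i' : Fin m' ↪ Fin n'} (hF : RestrictsTo S F i) (hG : RestrictsTo S G i') :
    RestrictsTo S (tensorGate F G) (finSumEmb i i') := by
  obtain ⟨j, H, hH, hj⟩ := hF
  obtain ⟨j', H', hH', hj'⟩ := hG
  refine ⟨finSumEmb j j', tensorGate H H', hS _ (.tensor (.mem hH) (.mem hH')), fun u => ?_⟩
  obtain ⟨a, b, rfl⟩ := exists_eq_append u
  rw [padLast_finSumEmb, tensorGate_append, tensorGate_append, padLast_finSumEmb, hj, hj']

theorem exists_eq_padLast {k n : ℕ} (a : Fin n → Fin (k + 1)) :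
    ∃ (m : ℕ) (i : Fin m ↪ Fin n) (u : Fin m → Fin k), a = padLast i u := by
  obtain ⟨m, i, hi⟩ := exists_embedding_range_eq {y | a y ≠ Fin.last k}
  have ha (x : Fin m) : a (i x) ≠ Fin.last k := by
    have : i x ∈ {y | a y ≠ Fin.last k} := hi ▸ Set.mem_range_self x
    exact this
  refine ⟨m, i, fun x => (a (i x)).castPred (ha x), ?_⟩
  funext y
  by_cases hy : y ∈ Set.range i
  · obtain ⟨x, rfl⟩ := hy
    simp [padLast_apply]
  · rw [padLast_of_notMem _ _ hy]
    rw [hi] at hy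
    simpa using hy

/-- A gate obtained by fixing the first inputs to `a` restricts to gates of the class. -/
theorem RestrictsTo.ancilla {k l n m l₀ : ℕ} [NeZero k] {S : Set (Gate (Fin k))}
    (hS : IsGateClass S) {F : GateFun (Fin (k + 1)) (l + n)} {F' : GateFun (Fin (k + 1)) n}
    (i₀ : Fin l₀ ↪ Fin l) (a : Fin l₀ → Fin k) (i : Fin m ↪ Fin n)
    (hF : RestrictsTo S F (finSumEmb i₀ i))
    (h : ∀ b, F (Fin.append (padLast i₀ a) b) = Fin.append (padLast i₀ a) (F' b)) :
    RestrictsTo S F' i := by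
  obtain ⟨j, H, hH, hj⟩ := hF
  have key (u : Fin m → Fin k) :
      padLast j (H (Fin.append a u)) = Fin.append (padLast i₀ a) (F' (padLast i u)) := by
    rw [← hj, padLast_finSumEmb, h]
  obtain ⟨q, j', π, rfl⟩ := exists_equiv_trans_finSumEmb_eq i₀ j fun y => by
    rw [← padLast_ne_last_iff j (H (Fin.append a 0)), key, Fin.append_left, padLast_ne_last_iff]
  obtain rfl : m = q := by have := Fin.equiv_iff_eq.1 ⟨π⟩; omega
  let H' : GateFun (Fin k) (l₀ + m) := H.trans (permGate _ π.symm)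
  have key' (u : Fin m → Fin k) :
      ∃ v, H' (Fin.append a u) = Fin.append a v ∧ F' (padLast i u) = padLast j' v := by
    obtain ⟨b, v, hbv⟩ := exists_eq_append (H' (Fin.append a u))
    have hu := key u
    rw [padLast_trans] at hu
    change padLast _ (H' (Fin.append a u)) = _ at hu
    rw [hbv, padLast_finSumEmb] at hu
    obtain ⟨h₁, h₂⟩ := append_inj hu
    exact ⟨v, by rw [hbv, padLast_injective i₀ h₁], h₂.symm⟩
  choose v hv hF' using key'
  have hinj : Function.Injective v := fun u u' huu' =>
    padLast_injective i (F'.injective (by rw [hF', hF', huu']))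
  refine ⟨j', Equiv.ofBijective v (Finite.injective_iff_bijective.1 hinj),
    hS _ (.ancilla a (.mem (hS.trans_mem hH (hS.permGate_mem π.symm))) fun b => ?_), hF'⟩
  rw [splitEquiv_symm_apply, splitEquiv_symm_apply]
  exact hv b

theorem Generates.restrictsTo {k m : ℕ} [NeZero k] {S : Set (Gate (Fin k))}
    (hS : IsGateClass S) {g : Gate (Fin (k + 1))} (hg : Generates (pgate '' S) g)
    (i : Fin m ↪ Fin g.1) : RestrictsTo S g.2 i := by
  induction hg generalizing m with
  | mem hg =>
    obtain ⟨g, hg, rfl⟩ := hg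
    exact restrictsTo_extendDomain hS hg i
  | perm n σ =>
    exact ⟨i.trans σ.symm.toEmbedding, Equiv.refl _, hS.refl_mem m,
      fun u => padLast_comp_perm σ i u⟩
  | @tensor n n' F G _ _ hF hG =>
    obtain ⟨l₀, i₀, hi₀⟩ := exists_embedding_range_eq {y | Fin.castAdd n' y ∈ Set.range i}
    obtain ⟨q, i', π, rfl⟩ := exists_equiv_trans_finSumEmb_eq i₀ i fun y => by
      rw [hi₀, Set.mem_ofPred_eq]
    exact ((hF i₀).tensor hS (hG i')).trans_equiv hS π
  | comp _ _ hF hG =>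
    obtain ⟨j, H, hH, hj⟩ := hG i
    obtain ⟨j', H', hH', hj'⟩ := hF j
    refine ⟨j', H.trans H', hS.trans_mem hH hH', fun u => ?_⟩
    simp only [Equiv.trans_apply, hj, hj']
  | ancilla a _ h hF =>
    obtain ⟨l₀, i₀, a, rfl⟩ := exists_eq_padLast a
    refine RestrictsTo.ancilla hS i₀ a i (hF _) fun b => ?_
    simpa only [splitEquiv_symm_apply] using h b

theorem mem_of_generates_pgate {k : ℕ} [NeZero k] {S : Set (Gate (Fin k))} (hS : IsGateClass S)
    {g : Gate (Fin k)} (hg : Generates (pgate '' S) (pgate g)) : g ∈ S := by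
  obtain ⟨n, F⟩ := g
  have hF : RestrictsTo S (Equiv.Perm.extendDomain F (liftEquiv k n)) (.refl _) :=
    hg.restrictsTo hS (Function.Embedding.refl (Fin n))
  obtain ⟨j, H, hH, hj⟩ := hF
  obtain ⟨π, rfl⟩ := exists_equiv_trans_refl_eq (Finite.injective_iff_surjective.1 j.injective)
  have hF : F = H.trans (permGate _ π.symm) := by
    ext1 u
    have hu := hj u
    rw [padLast_trans, padLast_refl, padLast_refl, extendDomain_castSucc] at hu
    exact (Fin.castSucc_injective k).comp_left hu
  rw [hF]
  exact hS.trans_mem hH (hS.permGate_mem _)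

/-- The map `S ↦ PS = ⟨PF : F ∈ S⟩` is a poset embedding of the poset `L_k` of
reversible gate classes over an alphabet of size `k ≥ 2` into the poset `L_{k+1}` of
reversible gate classes over an alphabet of size `k+1`: it is order-preserving and
injective (on gate classes). -/
theorem poset_embedding (k : ℕ) (hk : 2 ≤ k) :
    (∀ S T : Set (Gate (Fin k)), IsGateClass S → IsGateClass T → S ⊆ T →
      genClosure (pgate '' S) ⊆ genClosure (pgate '' T)) ∧
    (∀ S T : Set (Gate (Fin k)), IsGateClass S → IsGateClass T →
      genClosure (pgate '' S) = genClosure (pgate '' T) → S = T) := by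
  have : NeZero k := ⟨by omega⟩
  refine ⟨fun S T _ _ hST g hg => hg.mono (Set.image_mono hST), fun S T hS hT h => ?_⟩
  have hle {S T : Set (Gate (Fin k))} (hT : IsGateClass T)
      (h : genClosure (pgate '' S) ⊆ genClosure (pgate '' T)) : S ⊆ T := fun g hg =>
    mem_of_generates_pgate hT (h (.mem (Set.mem_image_of_mem _ hg)))
  exact (hle hT h.subset).antisymm (hle hS h.superset)
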